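/- arXiv:1110.6828 — 4 statements merged into one kernel-verified Lean document; each statement's English description precedes it below -/
import Mathlib

section
/- Let L be a finitely generated S-module and φ : L → L a σ-semilinear map. Then the map L → L given by x ↦ x − φ(x) is surjective. -/
open Polynomial in
/-- Recursive polynomials: `c_i = (sol a i)(z ^ 2)`. -/
noncomputable def solPoly {R : Type} [CommRing R] (a : ℕ → R) : ℕ → R[X]
  | 0 => 1 + C (a 0) * X
  | (i + 1) => (solPoly a i) ^ 2 + C (a (i + 1)) * X

theorem root_in_k (k : Type) [Field k] [CharP k 2] [IsAlgClosed k] (Q : Polynomial k) :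
    ∃ z : k, Q.eval (z ^ 2) = z := by
  classical
  have hder : Polynomial.derivative (Q.comp (Polynomial.X ^ 2) - Polynomial.X) = -1 := by
    have h2 : (2 : Polynomial k) = 0 := by
      have := CharP.cast_eq_zero (Polynomial k) 2
      exact_mod_cast this
    have hX : Polynomial.derivative (Polynomial.X ^ 2 : Polynomial k) = 0 := by
      rw [pow_two, Polynomial.derivative_mul, Polynomial.derivative_X]
      linear_combination Polynomial.X * h2
    rw [Polynomial.derivative_sub, Polynomial.derivative_comp, hX, Polynomial.derivative_X]
    simp
  have hdeg : (Q.comp (Polynomial.X ^ 2) - Polynomial.X).degree ≠ 0 := by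
    intro h
    rw [Polynomial.eq_C_of_degree_eq_zero h] at hder
    simp at hder
  obtain ⟨z, hz⟩ := IsAlgClosed.exists_root _ hdeg
  refine ⟨z, ?_⟩
  simpa [Polynomial.IsRoot, sub_eq_zero] using hz

theorem root_in_S (k : Type) [Field k] [CharP k 2] [IsAlgClosed k]
    (Q : Polynomial (PowerSeries k)) :
    ∃ z : PowerSeries k, Q.eval (z ^ 2) = z := by
  obtain ⟨z0, hz0⟩ := root_in_k k (Q.map (PowerSeries.constantCoeff (R := k)))
  have h2 : (2 : PowerSeries k) = 0 := by
    have : (2 : k) = 0 := by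
      have := CharP.cast_eq_zero k 2
      exact_mod_cast this
    have h := congrArg (PowerSeries.C (R := k)) this
    rwa [map_zero, map_ofNat] at h
  have key : ∀ (n : ℕ) (a b : PowerSeries k), PowerSeries.X ^ (n + 1) ∣ a - b →
      PowerSeries.X ^ (n + 2) ∣ Q.eval (a ^ 2) - Q.eval (b ^ 2) := by
    intro n a b h
    refine dvd_trans ?_ (Polynomial.sub_dvd_eval_sub (a ^ 2) (b ^ 2) Q)
    have e : a ^ 2 - b ^ 2 = (a - b) * (a - b) := by
      linear_combination (a * b - b ^ 2) * h2
    rw [e, pow_succ]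
    exact mul_dvd_mul h ((dvd_pow_self _ (Nat.succ_ne_zero n)).trans h)
  let F : PowerSeries k → PowerSeries k := fun z => Q.eval (z ^ 2)
  let x : ℕ → PowerSeries k := fun n => F^[n] (PowerSeries.C z0)
  have hx : ∀ n, x (n + 1) = F (x n) := fun n => Function.iterate_succ_apply' F n _
  have hstep : ∀ n, PowerSeries.X ^ (n + 1) ∣ x (n + 1) - x n := by
    intro n
    induction n with
    | zero =>
      rw [zero_add, pow_one, PowerSeries.X_dvd_iff, hx, map_sub]
      have : PowerSeries.constantCoeff (Q.eval ((PowerSeries.C z0) ^ 2)) = z0 := by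
        rw [← Polynomial.eval_map_apply]
        simpa using hz0
      change PowerSeries.constantCoeff (Q.eval ((PowerSeries.C z0) ^ 2)) -
        PowerSeries.constantCoeff (PowerSeries.C z0) = 0
      rw [this]; simp
    | succ n ih =>
      have := key n _ _ ih
      rw [hx (n + 1)]
      nth_rewrite 2 [hx n]
      exact this
  have hmono : ∀ n m, PowerSeries.X ^ (n + 1) ∣ x (n + m) - x n := by
    intro n m
    induction m with
    | zero => simp
    | succ m ih =>
      have h := (pow_dvd_pow PowerSeries.X (by omega : n + 1 ≤ n + m + 1)).trans (hstep (n + m))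
      have := dvd_add h ih
      simpa [← add_assoc] using this
  let z : PowerSeries k := PowerSeries.mk fun n => PowerSeries.coeff n (x n)
  have hz : ∀ n, PowerSeries.X ^ (n + 1) ∣ z - x n := by
    intro n
    rw [PowerSeries.X_pow_dvd_iff]
    intro m hm
    obtain ⟨j, rfl⟩ := Nat.exists_eq_add_of_le (Nat.lt_succ_iff.mp hm)
    have := PowerSeries.X_pow_dvd_iff.mp (hmono m j) m (Nat.lt_succ_self m)
    rw [map_sub, sub_eq_zero] at this
    simp [z, this]
  refine ⟨z, ?_⟩
  have hall : ∀ n, PowerSeries.X ^ (n + 1) ∣ Q.eval (z ^ 2) - z := by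
    intro n
    have h1 := (pow_dvd_pow PowerSeries.X (by omega : n + 1 ≤ n + 2)).trans (key n _ _ (hz n))
    have h3 := hstep n
    rw [hx] at h3
    have := dvd_sub (dvd_add h1 h3) (hz n)
    convert this using 1
    simp only [F]; ring
  rw [← sub_eq_zero]
  ext n
  simpa using PowerSeries.X_pow_dvd_iff.mp (hall n) n (Nat.lt_succ_self n)

theorem exists_rel {R L : Type} [CommRing R] [IsNoetherianRing R] [AddCommGroup L] [Module R L]
    [Module.Finite R L] (v : ℕ → L) :
    ∃ (r : ℕ) (a : ℕ → R), v (r + 1) = ∑ i ∈ Finset.range (r + 1), a i • v i := by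
  let N : ℕ →o Submodule R L :=
    ⟨fun n => Submodule.span R (v '' (Finset.range n : Set ℕ)), fun i j h =>
      Submodule.span_mono (Set.image_mono (by simpa using h))⟩
  obtain ⟨n, hn⟩ := monotone_stabilizes_iff_noetherian.mpr
    (inferInstance : IsNoetherian R L) N
  refine ⟨n, ?_⟩
  have h1 : v (n + 1) ∈ N (n + 2) := Submodule.subset_span ⟨n + 1, by simp, rfl⟩
  rw [← hn (n + 2) (by omega), hn (n + 1) (by omega)] at h1
  obtain ⟨a, ha⟩ := (Submodule.mem_span_image_finset_iff_exists_fun R).mp h1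
  refine ⟨fun i => if h : i ∈ Finset.range (n + 1) then a ⟨i, h⟩ else 0, ?_⟩
  rw [← ha, ← Finset.sum_coe_sort (Finset.range (n + 1))]
  refine Finset.sum_congr (M := L) rfl fun i _ => ?_
  beta_reduce
  rw [dif_pos i.2]

/-- **Lemma 1.1(a)** of Abrashkin, "Group schemes of period 2":
Let `k` be an algebraically closed field of characteristic 2, `S = k⟦t⟧` and
`σ : S → S` the Frobenius `s ↦ s²`.  If `L` is a finitely generated `S`-module and
`φ : L → L` is a `σ`-semilinear (i.e. additive and `φ (s • m) = s ^ 2 • φ m`) map,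
then `x ↦ x - φ x` is surjective. -/
theorem semilinear_one_sub_surjective
    (k : Type) [Field k] [CharP k 2] [IsAlgClosed k]
    (L : Type) [AddCommGroup L] [Module (PowerSeries k) L]
    [Module.Finite (PowerSeries k) L]
    (φ : L →+ L)
    (hφ : ∀ (s : PowerSeries k) (m : L), φ (s • m) = s ^ 2 • φ m) :
    Function.Surjective (fun x : L => x - φ x) := by
  intro y
  let v : ℕ → L := fun n => φ^[n] y
  have hv : ∀ n, φ (v n) = v (n + 1) := fun n => (Function.iterate_succ_apply' φ n y).symm
  obtain ⟨r, a, ha⟩ := exists_rel (R := PowerSeries k) v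
  obtain ⟨z, hz⟩ := root_in_S k (solPoly a r)
  let c : ℕ → PowerSeries k := fun i => (solPoly a i).eval (z ^ 2)
  have hc0 : c 0 = 1 + a 0 * z ^ 2 := by simp [c, solPoly]
  have hcs : ∀ i, c (i + 1) = c i ^ 2 + a (i + 1) * z ^ 2 := by intro i; simp [c, solPoly]
  have hcr : c r = z := hz
  have main : ∀ n, ∑ i ∈ Finset.range (n + 1), c i • v i
      - ∑ i ∈ Finset.range (n + 1), c i ^ 2 • v (i + 1)
      = y + z ^ 2 • ∑ i ∈ Finset.range (n + 1), a i • v i - c n ^ 2 • v (n + 1) := by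
    intro n
    induction n with
    | zero =>
      have : v 0 = y := rfl
      simp [hc0, this, add_smul, mul_smul, smul_comm (a 0) (z ^ 2)]
    | succ n ih =>
      rw [Finset.sum_range_succ, Finset.sum_range_succ _ (n + 1),
        Finset.sum_range_succ (fun i => a i • v i) (n + 1), add_sub_add_comm, ih, smul_add]
      have : c (n + 1) • v (n + 1) = c n ^ 2 • v (n + 1) + z ^ 2 • a (n + 1) • v (n + 1) := by
        rw [hcs, add_smul, mul_comm, mul_smul]
      rw [this]
      abel
  refine ⟨∑ i ∈ Finset.range (r + 1), c i • v i, ?_⟩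
  have hm := main r
  rw [← ha, hcr] at hm
  simp only [map_sum, hφ, hv]
  rw [hm]
  abel
end

section
/- Let L be a finitely generated S-module and φ : L → L a σ-semilinear map which is topologically nilpotent, i.e. ⋂_{n≥0} φⁿ(L) = 0, where φⁿ(L) denotes the image of the n-fold iterate of φ. Then the map L → L given by x ↦ x − φ(x) is bijective. -/
open Polynomial in
lemma aux_residue (k : Type) [Field k] [IsAlgClosed k] (r : k[X]) :
    ∃ c : k, c = r.eval (c ^ 2) := by
  have hc : (X - expand k 2 r).coeff 1 = 1 := by
    rw [coeff_sub, coeff_X_one, coeff_expand (by norm_num)]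
    simp
  have hd : (X - expand k 2 r).degree ≠ 0 := by
    intro h
    rw [eq_C_of_degree_eq_zero h] at hc
    simp at hc
  obtain ⟨c, h⟩ := IsAlgClosed.exists_root _ hd
  refine ⟨c, ?_⟩
  rw [IsRoot.def, eval_sub, eval_X, expand_eval] at h
  exact sub_eq_zero.mp h

open Polynomial in
/-- Hensel-type fixed point. -/
lemma aux_fixed (k : Type) [Field k] [CharP k 2] [IsAlgClosed k]
    (R : Polynomial (PowerSeries k)) :
    ∃ c : PowerSeries k, c = R.eval (c ^ 2) := by
  obtain ⟨c₀, h₀⟩ := aux_residue k (R.map (PowerSeries.constantCoeff (R := k)))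
  have h2 : (2 : PowerSeries k) = 0 := by
    have : (2 : k) = 0 := CharP.cast_eq_zero k 2
    have h := congrArg (PowerSeries.C (R := k)) this
    rwa [map_ofNat, map_zero] at h
  have key : ∀ u v : PowerSeries k, (u - v) ^ 2 ∣ R.eval (u ^ 2) - R.eval (v ^ 2) := by
    intro u v
    have h : (u - v) ^ 2 = u ^ 2 - v ^ 2 := by linear_combination (v ^ 2 - u * v) * h2
    rw [h]
    exact sub_dvd_eval_sub _ _ _
  let s : ℕ → PowerSeries k := fun n => (fun c => R.eval (c ^ 2))^[n] (PowerSeries.C c₀)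
  have hs : ∀ n, s (n + 1) = R.eval (s n ^ 2) := fun n => by
    simp only [s, Function.iterate_succ_apply']
  have hstep : ∀ n, (PowerSeries.X : PowerSeries k) ^ (n + 1) ∣ s (n + 1) - s n := by
    intro n
    induction n with
    | zero =>
      rw [zero_add, pow_one, PowerSeries.X_dvd_iff, ← zero_add 1, hs 0]
      simp only [s, Function.iterate_zero, id, map_sub, PowerSeries.constantCoeff_C]
      rw [sub_eq_zero]
      conv_rhs => rw [h₀]
      rw [← eval_map_apply]
      simp
    | succ n ih =>
      rw [hs (n + 1), hs n]
      refine dvd_trans ?_ (key _ _)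
      rw [← hs n]
      refine dvd_trans ?_ (pow_dvd_pow_of_dvd ih 2)
      rw [← pow_mul]
      exact pow_dvd_pow _ (by omega)
  have hco : ∀ n m, n < m → PowerSeries.coeff n (s m) = PowerSeries.coeff n (s (n + 1)) := by
    intro n m hm
    induction m, hm using Nat.le_induction with
    | base => rfl
    | succ m hm ih =>
      rw [← ih, ← sub_eq_zero, ← map_sub]
      exact PowerSeries.X_pow_dvd_iff.mp (hstep m) n (by omega)
  let c : PowerSeries k := PowerSeries.mk fun n => PowerSeries.coeff n (s (n + 1))
  have hc : ∀ m, (PowerSeries.X : PowerSeries k) ^ m ∣ c - s m := by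
    intro m
    rw [PowerSeries.X_pow_dvd_iff]
    intro n hn
    rw [map_sub, PowerSeries.coeff_mk, hco n m hn, sub_self]
  refine ⟨c, ?_⟩
  rw [← sub_eq_zero]
  ext n
  refine PowerSeries.X_pow_dvd_iff (n := n + 1).mp ?_ n (by omega)
  have e : c - R.eval (c ^ 2) = (c - s (n + 2)) - (R.eval (c ^ 2) - R.eval (s (n + 1) ^ 2)) := by
    rw [hs (n + 1)]; ring
  rw [e]
  refine dvd_sub (dvd_trans (pow_dvd_pow _ (by omega)) (hc (n + 2))) ?_
  exact dvd_trans (dvd_trans (hc (n + 1)) (dvd_pow_self _ two_ne_zero)) (key _ _)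

/-- The auxiliary polynomials. -/
noncomputable def auxPoly {S : Type} [CommRing S] (a : ℕ → S) : ℕ → Polynomial S
  | 0 => 1 + Polynomial.C (a 0) * Polynomial.X
  | n + 1 => (auxPoly a n) ^ 2 + Polynomial.C (a (n + 1)) * Polynomial.X

/-- **Lemma 1.1(b)** of Abrashkin, "Group schemes of period 2":
Let `k` be an algebraically closed field of characteristic 2, `S = k⟦t⟧` and
`σ : S → S` the Frobenius `s ↦ s²`.  If `L` is a finitely generated `S`-module and
`φ : L → L` is a `σ`-semilinear map which is topologically nilpotent, i.e.
`⋂ n φⁿ(L) = 0`, then `x ↦ x - φ x` is bijective. -/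
theorem semilinear_one_sub_bijective_of_topNilpotent
    (k : Type) [Field k] [CharP k 2] [IsAlgClosed k]
    (L : Type) [AddCommGroup L] [Module (PowerSeries k) L]
    [Module.Finite (PowerSeries k) L]
    (φ : L →+ L)
    (hφ : ∀ (s : PowerSeries k) (m : L), φ (s • m) = s ^ 2 • φ m)
    (hnil : (⋂ n : ℕ, Set.range ((⇑φ)^[n])) = {0}) :
    Function.Bijective (fun x : L => x - φ x) := by
  constructor
  · intro x y hxy
    have hxy : x - φ x = y - φ y := hxy
    have hfix : φ (x - y) = x - y := by
      rw [map_sub, ← sub_eq_zero]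
      have := sub_eq_zero.mpr hxy
      rw [← neg_eq_zero, ← this]; abel
    have hmem : x - y ∈ (⋂ n : ℕ, Set.range ((⇑φ)^[n])) :=
      Set.mem_iInter.mpr fun n => ⟨x - y, Function.iterate_fixed hfix n⟩
    rw [hnil] at hmem
    exact sub_eq_zero.mp hmem
  · intro y
    let N : ℕ →o Submodule (PowerSeries k) L :=
      ⟨fun n => Submodule.span _ ((fun i => φ^[i] y) '' (Finset.range n : Set ℕ)),
        fun i j hij => Submodule.span_mono (Set.image_mono (by
          intro x hx; simp at hx ⊢; omega))⟩
    obtain ⟨n, hn⟩ := monotone_stabilizes_iff_noetherian.mpr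
      (inferInstance : IsNoetherian (PowerSeries k) L) N
    have hmem : φ^[n + 1] y ∈ N (n + 1) := by
      rw [← hn (n + 1) (by omega), hn (n + 2) (by omega)]
      exact Submodule.subset_span ⟨n + 1, by simp, rfl⟩
    obtain ⟨a, ha⟩ : ∃ a : ℕ → PowerSeries k,
        ∑ i ∈ Finset.range (n + 1), a i • φ^[i] y = φ^[n + 1] y := by
      obtain ⟨b, hb⟩ := (Submodule.mem_span_image_finset_iff_exists_fun _).mp hmem
      refine ⟨fun i => if h : i ∈ Finset.range (n + 1) then b ⟨i, h⟩ else 0, ?_⟩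
      rw [← hb, ← Finset.sum_coe_sort]
      refine Finset.sum_congr rfl fun i _ => ?_
      simp only [dif_pos i.2, Subtype.coe_eta]
    obtain ⟨c, hc⟩ := aux_fixed k (auxPoly a n)
    have main : ∀ m, (∑ i ∈ Finset.range (m + 1), (auxPoly a i).eval (c ^ 2) • φ^[i] y)
        - φ (∑ i ∈ Finset.range (m + 1), (auxPoly a i).eval (c ^ 2) • φ^[i] y)
        = y + c ^ 2 • (∑ i ∈ Finset.range (m + 1), a i • φ^[i] y)
          - ((auxPoly a m).eval (c ^ 2)) ^ 2 • φ^[m + 1] y := by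
      intro m
      induction m with
      | zero =>
        simp only [zero_add, Finset.sum_range_one, hφ, Function.iterate_succ_apply',
          Function.iterate_zero, id]
        have : (auxPoly a 0).eval (c ^ 2) = 1 + c ^ 2 * a 0 := by
          rw [mul_comm]; simp [auxPoly]
        generalize (auxPoly a 0).eval (c ^ 2) = d at this ⊢
        rw [show d • y = _ • y from by rw [this], add_smul, one_smul, mul_smul]
      | succ m ih =>
        rw [Finset.sum_range_succ, map_add, add_sub_add_comm, ih,
          Finset.sum_range_succ (fun i => a i • φ^[i] y) (m + 1), hφ,
          ← Function.iterate_succ_apply' φ (m + 1)]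
        have : (auxPoly a (m + 1)).eval (c ^ 2)
            = (auxPoly a m).eval (c ^ 2) ^ 2 + c ^ 2 * a (m + 1) := by
          rw [mul_comm]; simp [auxPoly]
        generalize (auxPoly a (m + 1)).eval (c ^ 2) = d at this ⊢
        rw [show d • φ^[m + 1] y = _ • φ^[m + 1] y from by rw [this], add_smul, mul_smul, smul_add]
        abel
    refine ⟨_, (main n).trans ?_⟩
    rw [← hc, ha]
    abel
end

section
/- For i = 1, 2 let (Mᵢ⁰, Mᵢ¹, φ₁) be objects of MF^e_S, let (Nᵢ⁰, Nᵢ¹, φ₁) be objects of 𝓜𝓕_S, and let θᵢ : (Mᵢ⁰, Mᵢ¹, φ₁) → (Nᵢ⁰, Nᵢ¹, φ₁) be φ₁-lifts, with θ₂ a nilpotent φ₁-lift. Let h : (N₁⁰, N₁¹, φ₁) → (N₂⁰, N₂¹, φ₁) be a morphism. Then there is exactly one morphism f : (M₁⁰, M₁¹, φ₁) → (M₂⁰, M₂¹, φ₁) with θ₂ ∘ f = h ∘ θ₁. -/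
/-! Setup for Proposition 1.1 of Abrashkin, "Group schemes of period 2".
`S = k⟦t⟧` with `k` algebraically closed of characteristic 2, `σ : s ↦ s²`.
A triple `(M, M1, φ)` consists of an `S`-module `M`, a submodule `M1 ⊆ M` and a
map `φ : M → M` which is additive and `σ`-semilinear on `M1` (this encodes the
`σ`-semilinear map `φ₁ : M¹ → M⁰`; the values of `φ` outside `M1` are irrelevant
since every condition below only refers to its restriction to `M1`). -/

/-- `(N, N1, φ)` is an object of the category `𝓜𝓕_S`. -/
def IsMFTriple (k : Type) [Field k]
    (N : Type) [AddCommGroup N] [Module (PowerSeries k) N]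
    (N1 : Submodule (PowerSeries k) N) (φ : N → N) : Prop :=
  (∀ a ∈ N1, ∀ b ∈ N1, φ (a + b) = φ a + φ b) ∧
  (∀ (s : PowerSeries k), ∀ a ∈ N1, φ (s • a) = s ^ 2 • φ a)

/-- `(M, M1, φ)` is an object of the category `MF^e_S`:  `M` is finite free over
`S`, `t^e·M ⊆ M1`, and `φ₁(M1)` generates `M` over `S`. -/
def IsMFeTriple (k : Type) [Field k] (e : ℕ)
    (M : Type) [AddCommGroup M] [Module (PowerSeries k) M]
    (M1 : Submodule (PowerSeries k) M) (φ : M → M) : Prop :=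
  IsMFTriple k M M1 φ ∧
  Module.Free (PowerSeries k) M ∧ Module.Finite (PowerSeries k) M ∧
  (∀ m : M, (PowerSeries.X : PowerSeries k) ^ e • m ∈ M1) ∧
  Submodule.span (PowerSeries k) (φ '' (M1 : Set M)) = ⊤

/-- `f` is a morphism of triples `(M, M1, φM) → (N, N1, φN)`. -/
def IsMFMorphism (k : Type) [Field k]
    (M : Type) [AddCommGroup M] [Module (PowerSeries k) M]
    (N : Type) [AddCommGroup N] [Module (PowerSeries k) N]
    (M1 : Submodule (PowerSeries k) M) (N1 : Submodule (PowerSeries k) N)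
    (φM : M → M) (φN : N → N) (f : M →ₗ[PowerSeries k] N) : Prop :=
  M1.map f ≤ N1 ∧ ∀ a ∈ M1, f (φM a) = φN (f a)

/-- `θ` is a `φ₁`-lift: a morphism with `θ(M⁰) = N⁰`, `θ(M¹) = N¹` and
`ker θ ⊆ M¹`. -/
def IsPhiLift (k : Type) [Field k]
    (M : Type) [AddCommGroup M] [Module (PowerSeries k) M]
    (N : Type) [AddCommGroup N] [Module (PowerSeries k) N]
    (M1 : Submodule (PowerSeries k) M) (N1 : Submodule (PowerSeries k) N)
    (φM : M → M) (φN : N → N) (θ : M →ₗ[PowerSeries k] N) : Prop :=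
  IsMFMorphism k M N M1 N1 φM φN θ ∧
  Function.Surjective θ ∧ M1.map θ = N1 ∧ LinearMap.ker θ ≤ M1

/-- `θ` is a nilpotent `φ₁`-lift:  `φ₁` is topologically nilpotent on
`T = ker θ`, i.e. `⋂ₙ φ₁ⁿ(T) = 0`. -/
def IsNilpotentPhiLift (k : Type) [Field k]
    (M : Type) [AddCommGroup M] [Module (PowerSeries k) M]
    (N : Type) [AddCommGroup N] [Module (PowerSeries k) N]
    (M1 : Submodule (PowerSeries k) M) (N1 : Submodule (PowerSeries k) N)
    (φM : M → M) (φN : N → N) (θ : M →ₗ[PowerSeries k] N) : Prop :=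
  IsPhiLift k M N M1 N1 φM φN θ ∧
  (⋂ n : ℕ, φM^[n] '' (LinearMap.ker θ : Set M)) = {0}

namespace PhiLiftAux

open PowerSeries

/-- Completeness of finite free modules. -/
lemma complete_aux (k : Type) [Field k] (H : Type) [AddCommGroup H]
    [Module (PowerSeries k) H] [Module.Free (PowerSeries k) H] [Module.Finite (PowerSeries k) H]
    (z : ℕ → H) (hz : ∀ n, ∃ w, z (n + 1) - z n = (X : PowerSeries k) ^ n • w) :
    ∃ L, ∀ n, ∃ w, L - z n = (X : PowerSeries k) ^ n • w := by
  classical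
  let b := Module.Free.chooseBasis (PowerSeries k) H
  let c : H ≃ₗ[PowerSeries k] _ := b.equivFun
  have step : ∀ i n m, m < n → coeff m (c (z (n + 1)) i) = coeff m (c (z n) i) := by
    intro i n m hmn
    obtain ⟨w, hw⟩ := hz n
    have h1 : c (z (n + 1)) i - c (z n) i = X ^ n * c w i := by
      have := congrFun (congrArg c hw) i
      simpa using this
    have h2 : coeff m (c (z (n + 1)) i - c (z n) i) = 0 := by
      rw [h1, coeff_X_pow_mul', if_neg (by omega)]
    rw [map_sub] at h2
    exact sub_eq_zero.mp h2
  have stab : ∀ i n m, m < n → coeff m (c (z n) i) = coeff m (c (z (m + 1)) i) := by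
    intro i n m hmn
    induction n, hmn using Nat.le_induction with
    | base => rfl
    | succ n hn ih => rw [step i n m (by omega), ih]
  let L : H := c.symm (fun i => PowerSeries.mk fun m => coeff m (c (z (m + 1)) i))
  refine ⟨L, fun n => ?_⟩
  have hd : ∀ i, ∃ q, c (L - z n) i = X ^ n * q := by
    intro i
    change (X : PowerSeries k) ^ n ∣ _
    rw [X_pow_dvd_iff]
    intro m hm
    simp only [map_sub, L, LinearEquiv.apply_symm_apply, Pi.sub_apply, coeff_mk]
    rw [stab i n m hm, sub_self]
  choose q hq using hd
  refine ⟨c.symm q, c.injective ?_⟩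
  funext i
  rw [hq i]
  simp

lemma separated_aux (k : Type) [Field k] (H : Type) [AddCommGroup H]
    [Module (PowerSeries k) H] [Module.Free (PowerSeries k) H] [Module.Finite (PowerSeries k) H]
    (x : H) (hx : ∀ n : ℕ, ∃ w, x = (X : PowerSeries k) ^ n • w) : x = 0 := by
  classical
  let b := Module.Free.chooseBasis (PowerSeries k) H
  let c : H ≃ₗ[PowerSeries k] _ := b.equivFun
  apply c.injective
  funext i
  ext m
  obtain ⟨w, hw⟩ := hx (m + 1)
  have h1 : c x i = X ^ (m + 1) * c w i := by
    have := congrFun (congrArg c hw) i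
    simpa using this
  rw [h1, coeff_X_pow_mul', if_neg (by omega)]
  simp

lemma iter_smul (k : Type) [Field k] (T : Type) [AddCommGroup T]
    [Module (PowerSeries k) T] (φ : T →+ T)
    (hφ : ∀ (s : PowerSeries k) x, φ (s • x) = s ^ 2 • φ x) (n : ℕ) (s : PowerSeries k) (x : T) :
    φ^[n] (s • x) = s ^ (2 ^ n) • φ^[n] x := by
  induction n with
  | zero => simp
  | succ n ih => rw [Function.iterate_succ_apply', ih, hφ, ← pow_mul, ← pow_succ,
      Function.iterate_succ_apply']

lemma nilp_aux (k : Type) [Field k] [CharP k 2] [IsAlgClosed k] (T : Type) [AddCommGroup T]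
    [Module (PowerSeries k) T] [Module.Free (PowerSeries k) T] [Module.Finite (PowerSeries k) T]
    (φ : T →+ T) (hφ : ∀ (s : PowerSeries k) x, φ (s • x) = s ^ 2 • φ x)
    (h0 : ∀ x, (∀ n : ℕ, ∃ y, φ^[n] y = x) → x = 0) :
    ∃ N : ℕ, ∀ x, ∃ y, φ^[N] x = (X : PowerSeries k) • y := by
  classical
  let b := Module.Free.chooseBasis (PowerSeries k) T
  let c : T ≃ₗ[PowerSeries k] _ := b.equivFun
  let r : T → (Module.Free.ChooseBasisIndex (PowerSeries k) T → k) :=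
    fun x i => constantCoeff (c x i)
  have radd : ∀ x y, r (x + y) = r x + r y := fun x y => by funext i; simp [r]
  have rsub : ∀ x y, r (x - y) = r x - r y := fun x y => by funext i; simp [r]
  have rsmul : ∀ (s : PowerSeries k) x, r (s • x) = constantCoeff s • r x :=
    fun s x => by funext i; simp [r]
  have rzero : ∀ x, r x = 0 → ∃ y, x = (X : PowerSeries k) • y := by
    intro x hx
    have : ∀ i, ∃ q, c x i = (X : PowerSeries k) * q := fun i => by
      change (X : PowerSeries k) ∣ _
      rw [X_dvd_iff]
      exact congrFun hx i
    choose q hq using this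
    refine ⟨c.symm q, c.injective ?_⟩
    funext i
    rw [hq i]
    simp
  let W : ℕ → Submodule k (Module.Free.ChooseBasisIndex (PowerSeries k) T → k) := fun n =>
    { carrier := {v | ∃ x, r (φ^[n] x) = v}
      add_mem' := by
        rintro _ _ ⟨x, rfl⟩ ⟨y, rfl⟩
        exact ⟨x + y, by rw [iterate_map_add, radd]⟩
      zero_mem' := ⟨0, by rw [iterate_map_zero]; funext i; simp [r]⟩
      smul_mem' := by
        rintro a _ ⟨x, rfl⟩
        obtain ⟨d, hd⟩ := IsAlgClosed.exists_pow_nat_eq a (n := 2 ^ n) (by positivity)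
        refine ⟨(C d : PowerSeries k) • x, ?_⟩
        rw [iter_smul k T φ hφ, rsmul]
        simp [hd] }
  have Wanti : Antitone W := antitone_nat_of_succ_le (by
    rintro n _ ⟨x, rfl⟩
    exact ⟨φ x, by rw [← Function.iterate_succ_apply]⟩)
  obtain ⟨N, hN⟩ := IsArtinian.monotone_stabilizes
    (⟨fun n => OrderDual.toDual (W n), fun a b hab => Wanti hab⟩ :
      ℕ →o (Submodule k (Module.Free.ChooseBasisIndex (PowerSeries k) T → k))ᵒᵈ)
  have hN1 : W N = W (N + 1) := hN (N + 1) (by omega)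
  refine ⟨N, fun x => rzero _ ?_⟩
  by_contra hne
  have ex : ∀ y : {y : T // r y ∈ W N}, ∃ y' : {y : T // r y ∈ W N},
      ∃ w, φ y'.1 - y.1 = (X : PowerSeries k) • w := by
    rintro ⟨y, hy⟩
    have hy2 := hy
    rw [hN1] at hy2
    obtain ⟨u, hu⟩ := hy2
    refine ⟨⟨φ^[N] u, u, rfl⟩, rzero _ ?_⟩
    rw [rsub, ← Function.iterate_succ_apply' (f := φ), hu, sub_self]
  choose g hg using ex
  let y : ℕ → T := fun j => (g^[j] ⟨φ^[N] x, x, rfl⟩).1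
  have hy : ∀ j, ∃ w, φ (y (j + 1)) - y j = (X : PowerSeries k) • w := by
    intro j
    simp only [y, Function.iterate_succ_apply']
    exact hg _
  have lim : ∀ j, ∃ L, ∀ n, ∃ w, L - φ^[n] (y (j + n)) = (X : PowerSeries k) ^ n • w := by
    intro j
    apply complete_aux
    intro n
    obtain ⟨w, hw⟩ := hy (j + n)
    refine ⟨(X : PowerSeries k) ^ (2 ^ n - n) • φ^[n] w, ?_⟩
    rw [Function.iterate_succ_apply, ← iterate_map_sub, ← add_assoc, hw, iter_smul k T φ hφ,
      smul_smul, ← pow_add, Nat.add_sub_cancel' (Nat.lt_two_pow_self).le]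
  choose L hL using lim
  have hLs : ∀ j, φ (L (j + 1)) = L j := by
    intro j
    rw [← sub_eq_zero]
    apply separated_aux k T
    intro n
    obtain ⟨w, hw⟩ := hL (j + 1) n
    obtain ⟨w', hw'⟩ := hL j (n + 1)
    have e1 : φ (L (j + 1)) - L j = φ (L (j + 1) - φ^[n] (y (j + 1 + n)))
        - (L j - φ^[n + 1] (y (j + (n + 1)))) := by
      rw [map_sub, Function.iterate_succ_apply', show j + 1 + n = j + (n + 1) by omega]
      abel
    refine ⟨(X : PowerSeries k) ^ n • φ w - (X : PowerSeries k) • w', ?_⟩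
    rw [e1, hw, hw', hφ, smul_sub, smul_smul, smul_smul, ← pow_succ, ← pow_mul, ← pow_add,
      mul_two]
  have hit : ∀ n j, φ^[n] (L (j + n)) = L j := by
    intro n
    induction n with
    | zero => intro j; rfl
    | succ n ih => intro j; rw [Function.iterate_succ_apply, ← add_assoc, hLs, ih]
  have hL0 : L 0 = 0 := h0 _ fun n => ⟨L (0 + n), hit n 0⟩
  -- compare `L 0` with `y 0` modulo `X`
  obtain ⟨w, hw⟩ := hL 0 1
  obtain ⟨w', hw'⟩ := hy 0
  apply hne
  have e2 : φ^[N] x = (X : PowerSeries k) • (-w - w') := by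
    have hw2 : L 0 - φ (y 1) = (X : PowerSeries k) • w := by simpa using hw
    have hw3 : φ (y 1) - y 0 = (X : PowerSeries k) • w' := by simpa using hw'
    change y 0 = _
    rw [smul_sub, smul_neg, ← hw2, ← hw3, hL0]
    abel
  rw [e2, rsmul]
  simp

lemma fixed_aux (k : Type) [Field k] (H : Type) [AddCommGroup H]
    [Module (PowerSeries k) H] [Module.Free (PowerSeries k) H] [Module.Finite (PowerSeries k) H]
    (Φ : H →+ H) (hΦ : ∀ (s : PowerSeries k) x, Φ (s • x) = s ^ 2 • Φ x)
    (hnil : ∃ N : ℕ, ∀ x, ∃ y, Φ^[N] x = (X : PowerSeries k) • y) (d : H) :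
    ∃! u, u = Φ u + d := by
  obtain ⟨N, hN⟩ := hnil
  have key : ∀ n x, ∃ y, Φ^[n * N] x = (X : PowerSeries k) ^ n • y := by
    intro n
    induction n with
    | zero => intro x; exact ⟨x, by simp⟩
    | succ n ih =>
      intro x
      obtain ⟨y, hy⟩ := ih x
      obtain ⟨y', hy'⟩ := hN y
      have hle : n ≤ n * 2 ^ N := Nat.le_mul_of_pos_right _ (by positivity)
      refine ⟨((X : PowerSeries k) ^ (n * 2 ^ N - n)) • y', ?_⟩
      rw [show (n + 1) * N = N + n * N by ring, Function.iterate_add_apply, hy,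
        iter_smul k H Φ hΦ, hy', smul_smul, smul_smul, ← pow_mul, ← pow_succ, ← pow_add]
      congr 2
      omega
  let A : H → H := fun u => Φ u + d
  have hA : ∀ m x y, A^[m] x - A^[m] y = Φ^[m] (x - y) := by
    intro m
    induction m with
    | zero => intro x y; rfl
    | succ m ih =>
      intro x y
      rw [Function.iterate_succ_apply, Function.iterate_succ_apply, ih,
        Function.iterate_succ_apply]
      simp [A]
  obtain ⟨L, hL⟩ := complete_aux k H (fun n => A^[n * N] 0) (by
    intro n
    rw [show (n + 1) * N = n * N + N by ring, Function.iterate_add_apply, hA]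
    exact key n _)
  refine ⟨L, ?_, ?_⟩
  · change L = A L
    rw [← sub_eq_zero]
    apply separated_aux k H
    intro n
    obtain ⟨w, hw⟩ := hL n
    obtain ⟨w', hw'⟩ := key n (A 0 - 0)
    rw [← hA, ← Function.iterate_succ_apply, Function.iterate_succ_apply'] at hw'
    have e1 : A L - A (A^[n * N] 0) = (X : PowerSeries k) ^ n • (X : PowerSeries k) ^ n • Φ w := by
      have := hA 1 L (A^[n * N] 0)
      simp only [Function.iterate_one] at this
      rw [this, hw, hΦ, smul_smul, ← pow_mul, ← pow_add, mul_two]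
    refine ⟨w - (X : PowerSeries k) ^ n • Φ w - w', ?_⟩
    rw [smul_sub, smul_sub, ← hw, ← e1, ← hw']
    abel
  · intro u hu
    change u = Φ u + d at hu
    have hLA : ∀ v : H, v = A v → ∀ n, A^[n] v = v := fun v hv n =>
      Function.iterate_fixed hv.symm n
    rw [← sub_eq_zero]
    apply separated_aux k H
    intro n
    obtain ⟨w, hw⟩ := hL n
    obtain ⟨w', hw'⟩ := key n u
    have e1 : u - A^[n * N] 0 = (X : PowerSeries k) ^ n • w' := by
      rw [← hw']
      have := hA (n * N) u 0
      rwa [hLA u hu, sub_zero] at this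
    refine ⟨w' - w, ?_⟩
    rw [smul_sub, ← hw, ← e1]
    abel

lemma univ_aux (k : Type) [Field k] (e : ℕ)
    (M : Type) [AddCommGroup M] [Module (PowerSeries k) M]
    (M1 : Submodule (PowerSeries k) M) (φ : M → M) (hM : IsMFeTriple k e M M1 φ)
    (P : Type) [AddCommGroup P] [Module (PowerSeries k) P]
    (ψ : M → P) (hadd : ∀ a ∈ M1, ∀ b ∈ M1, ψ (a + b) = ψ a + ψ b)
    (hsmul : ∀ (s : PowerSeries k), ∀ a ∈ M1, ψ (s • a) = s ^ 2 • ψ a) :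
    ∃ g : M →ₗ[PowerSeries k] P, ∀ a ∈ M1, g (φ a) = ψ a := by
  classical
  obtain ⟨⟨hφa, hφs⟩, hfree, hfin, hX, hspan⟩ := hM
  let b := Module.Free.chooseBasis (PowerSeries k) M1
  -- expansion of semilinear maps along the basis
  have expand : ∀ (Q : Type) [AddCommGroup Q] [Module (PowerSeries k) Q] (χ : M → Q),
      (∀ a ∈ M1, ∀ b ∈ M1, χ (a + b) = χ a + χ b) →
      (∀ (s : PowerSeries k), ∀ a ∈ M1, χ (s • a) = s ^ 2 • χ a) →
      ∀ a : M1, χ a = ∑ i, (b.repr a i) ^ 2 • χ (b i) := by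
    intro Q _ _ χ ha hs a
    let χ' : M1 →+ Q := AddMonoidHom.mk' (fun a => χ a) (fun x y => ha x x.2 y y.2)
    have h1 : χ' a = χ' (∑ i, b.repr a i • b i) := by rw [b.sum_repr]
    rw [map_sum] at h1
    refine h1.trans (Finset.sum_congr rfl fun i _ => ?_)
    exact hs _ _ (b i).2
  let p : (Module.Free.ChooseBasisIndex (PowerSeries k) M1 → PowerSeries k) →ₗ[PowerSeries k] M :=
    Fintype.linearCombination (PowerSeries k) (fun i => φ (b i))
  have psurj : Function.Surjective p := by
    rw [← LinearMap.range_eq_top, eq_top_iff, ← hspan, Submodule.span_le]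
    rintro _ ⟨a, ha, rfl⟩
    refine ⟨fun i => (b.repr ⟨a, ha⟩ i) ^ 2, ?_⟩
    rw [Fintype.linearCombination_apply]
    exact (expand M φ hφa hφs ⟨a, ha⟩).symm
  have hrank : Module.finrank (PowerSeries k) M = Module.finrank (PowerSeries k) M1 := by
    apply le_antisymm
    · let j : M →ₗ[PowerSeries k] M1 :=
        (LinearMap.lsmul (PowerSeries k) M ((X : PowerSeries k) ^ e)).codRestrict M1 hX
      apply LinearMap.finrank_le_finrank_of_injective (f := j)
      intro x y hxy
      have h1 : (X : PowerSeries k) ^ e • x = (X : PowerSeries k) ^ e • y :=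
        congrArg Subtype.val hxy
      exact smul_right_injective M (pow_ne_zero e X_ne_zero) h1
    · exact Submodule.finrank_le M1
  let eq : M ≃ₗ[PowerSeries k] (Module.Free.ChooseBasisIndex (PowerSeries k) M1 → PowerSeries k) :=
    LinearEquiv.ofFinrankEq _ _ (by
      rw [hrank, Module.finrank_eq_card_chooseBasisIndex, Module.finrank_fintype_fun_eq_card])
  have pinj : Function.Injective p := by
    have h1 : Function.Injective (eq.toLinearMap ∘ₗ p) :=
      OrzechProperty.injective_of_surjective_endomorphism _ (eq.surjective.comp psurj)
    exact Function.Injective.of_comp h1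
  let pe := LinearEquiv.ofBijective p ⟨pinj, psurj⟩
  refine ⟨Fintype.linearCombination (PowerSeries k) (fun i => ψ (b i)) ∘ₗ pe.symm.toLinearMap, ?_⟩
  intro a ha
  have h1 : pe.symm (φ a) = fun i => (b.repr ⟨a, ha⟩ i) ^ 2 := by
    rw [LinearEquiv.symm_apply_eq]
    change _ = p _
    rw [Fintype.linearCombination_apply]
    exact expand M φ hφa hφs ⟨a, ha⟩
  simp only [LinearMap.comp_apply, LinearEquiv.coe_coe, h1, Fintype.linearCombination_apply]
  exact (expand P ψ hadd hsmul ⟨a, ha⟩).symm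

lemma ext_aux (k : Type) [Field k] (e : ℕ)
    (M : Type) [AddCommGroup M] [Module (PowerSeries k) M]
    (M1 : Submodule (PowerSeries k) M) (φ : M → M) (hM : IsMFeTriple k e M M1 φ)
    (P : Type) [AddCommGroup P] [Module (PowerSeries k) P]
    (g g' : M →ₗ[PowerSeries k] P) (h : ∀ a ∈ M1, g (φ a) = g' (φ a)) : g = g' := by
  apply LinearMap.ext_on hM.2.2.2.2
  rintro _ ⟨a, ha, rfl⟩
  exact h a ha

/-- The main fixed point statement on `Hom(M, T)`. -/
lemma hom_aux (k : Type) [Field k] (e : ℕ)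
    (M : Type) [AddCommGroup M] [Module (PowerSeries k) M]
    (M1 : Submodule (PowerSeries k) M) (φ : M → M) (hM : IsMFeTriple k e M M1 φ)
    (T : Type) [AddCommGroup T]
    [Module (PowerSeries k) T] [Module.Free (PowerSeries k) T] [Module.Finite (PowerSeries k) T]
    (φT : T →+ T) (hφT : ∀ (s : PowerSeries k) x, φT (s • x) = s ^ 2 • φT x)
    (hnil : ∃ N : ℕ, ∀ x, ∃ y, φT^[N] x = (X : PowerSeries k) • y)
    (δ : M → T) (hadd : ∀ a ∈ M1, ∀ b ∈ M1, δ (a + b) = δ a + δ b)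
    (hsmul : ∀ (s : PowerSeries k), ∀ a ∈ M1, δ (s • a) = s ^ 2 • δ a) :
    ∃! u : M →ₗ[PowerSeries k] T, ∀ a ∈ M1, u (φ a) = φT (u a) + δ a := by
  classical
  obtain ⟨d, hd⟩ := univ_aux k e M M1 φ hM T δ hadd hsmul
  have := hM.2.1
  have := hM.2.2.1
  have exΦ : ∀ u : M →ₗ[PowerSeries k] T, ∃ g : M →ₗ[PowerSeries k] T,
      ∀ a ∈ M1, g (φ a) = φT (u a) := fun u =>
    univ_aux k e M M1 φ hM T (fun a => φT (u a)) (fun a _ b _ => by simp)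
      (fun s a _ => by simp [hφT])
  choose F hF using exΦ
  let Φ : (M →ₗ[PowerSeries k] T) →+ (M →ₗ[PowerSeries k] T) :=
    AddMonoidHom.mk' F (fun u v => ext_aux k e M M1 φ hM T _ _ fun a ha => by
      rw [hF _ a ha, LinearMap.add_apply, LinearMap.add_apply, map_add, hF _ a ha, hF _ a ha])
  have hΦ : ∀ u, ∀ a ∈ M1, Φ u (φ a) = φT (u a) := hF
  have hΦs : ∀ (s : PowerSeries k) u, Φ (s • u) = s ^ 2 • Φ u := fun s u =>
    ext_aux k e M M1 φ hM T _ _ fun a ha => by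
      rw [hΦ _ a ha, LinearMap.smul_apply, LinearMap.smul_apply, hφT, hΦ _ a ha]
  have hrange : ∀ (n : ℕ) u m,
      (Φ^[n] u) m ∈ Submodule.span (PowerSeries k) (Set.range φT^[n]) := by
    intro n
    induction n with
    | zero => intro u m; exact Submodule.subset_span ⟨u m, rfl⟩
    | succ n ih =>
      intro u m
      have hstep : ∀ x ∈ Submodule.span (PowerSeries k) (Set.range φT^[n]),
          φT x ∈ Submodule.span (PowerSeries k) (Set.range φT^[n + 1]) := by
        intro x hx
        induction hx using Submodule.span_induction with
        | mem x hx =>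
          obtain ⟨y, rfl⟩ := hx
          exact Submodule.subset_span ⟨y, Function.iterate_succ_apply' _ _ _⟩
        | zero => rw [map_zero]; exact Submodule.zero_mem _
        | add x y _ _ h1 h2 => rw [map_add]; exact Submodule.add_mem _ h1 h2
        | smul s x _ h1 => rw [hφT]; exact Submodule.smul_mem _ _ h1
      have hm : m ∈ Submodule.span (PowerSeries k) (φ '' (M1 : Set M)) := by
        rw [hM.2.2.2.2]; trivial
      induction hm using Submodule.span_induction with
      | mem x hx =>
        obtain ⟨a, ha, rfl⟩ := hx
        rw [Function.iterate_succ_apply', hΦ _ a ha]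
        exact hstep _ (ih u a)
      | zero => rw [map_zero]; exact Submodule.zero_mem _
      | add x y _ _ h1 h2 => rw [map_add]; exact Submodule.add_mem _ h1 h2
      | smul s x _ h1 => rw [map_smul]; exact Submodule.smul_mem _ _ h1
  have hnilΦ : ∃ N : ℕ, ∀ u, ∃ w, Φ^[N] u = (X : PowerSeries k) • w := by
    obtain ⟨N, hN⟩ := hnil
    refine ⟨N, fun u => ?_⟩
    have h1 : Submodule.span (PowerSeries k) (Set.range φT^[N]) ≤
        LinearMap.range (LinearMap.lsmul (PowerSeries k) T (X : PowerSeries k)) := by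
      rw [Submodule.span_le]
      rintro _ ⟨x, rfl⟩
      obtain ⟨y, hy⟩ := hN x
      exact ⟨y, hy.symm⟩
    have h2 : ∀ m, ∃ y, (X : PowerSeries k) • y = (Φ^[N] u) m := fun m => h1 (hrange N u m)
    choose y hy using h2
    let b := Module.Free.chooseBasis (PowerSeries k) M
    refine ⟨b.constr (PowerSeries k) (fun i => y (b i)), b.ext fun i => ?_⟩
    rw [LinearMap.smul_apply, b.constr_basis, hy]
  have iff1 : ∀ u : M →ₗ[PowerSeries k] T,
      (u = Φ u + d) ↔ ∀ a ∈ M1, u (φ a) = φT (u a) + δ a := by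
    intro u
    constructor
    · intro h a ha
      rw [← hΦ u a ha, ← hd a ha, ← LinearMap.add_apply, ← h]
    · intro h
      refine ext_aux k e M M1 φ hM T _ _ fun a ha => ?_
      rw [h a ha, LinearMap.add_apply, hΦ u a ha, hd a ha]
  obtain ⟨u, hu, huniq⟩ := fixed_aux k (M →ₗ[PowerSeries k] T) Φ hΦs hnilΦ d
  exact ⟨u, (iff1 u).1 hu, fun v hv => huniq v ((iff1 v).2 hv)⟩

end PhiLiftAux

/-- **Proposition 1.1(a)** of Abrashkin, "Group schemes of period 2":
given `φ₁`-lifts `θᵢ : 𝓜ᵢ → 𝓝ᵢ` (`𝓜ᵢ ∈ MF^e_S`, `𝓝ᵢ ∈ 𝓜𝓕_S`) with `θ₂`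
nilpotent, and a morphism `h : 𝓝₁ → 𝓝₂`, there is exactly one morphism
`f : 𝓜₁ → 𝓜₂` with `θ₂ ∘ f = h ∘ θ₁`. -/
theorem nilpotent_phiLift_existsUnique_lift
    (k : Type) [Field k] [CharP k 2] [IsAlgClosed k]
    (e : ℕ) (he : 1 ≤ e)
    (M₁ : Type) [AddCommGroup M₁] [Module (PowerSeries k) M₁]
    (M₂ : Type) [AddCommGroup M₂] [Module (PowerSeries k) M₂]
    (N₁ : Type) [AddCommGroup N₁] [Module (PowerSeries k) N₁]
    (N₂ : Type) [AddCommGroup N₂] [Module (PowerSeries k) N₂]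
    (M₁1 : Submodule (PowerSeries k) M₁) (M₂1 : Submodule (PowerSeries k) M₂)
    (N₁1 : Submodule (PowerSeries k) N₁) (N₂1 : Submodule (PowerSeries k) N₂)
    (φM₁ : M₁ → M₁) (φM₂ : M₂ → M₂) (φN₁ : N₁ → N₁) (φN₂ : N₂ → N₂)
    (hM₁ : IsMFeTriple k e M₁ M₁1 φM₁) (hM₂ : IsMFeTriple k e M₂ M₂1 φM₂)
    (hN₁ : IsMFTriple k N₁ N₁1 φN₁) (hN₂ : IsMFTriple k N₂ N₂1 φN₂)
    (θ₁ : M₁ →ₗ[PowerSeries k] N₁) (θ₂ : M₂ →ₗ[PowerSeries k] N₂)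
    (hθ₁ : IsPhiLift k M₁ N₁ M₁1 N₁1 φM₁ φN₁ θ₁)
    (hθ₂ : IsNilpotentPhiLift k M₂ N₂ M₂1 N₂1 φM₂ φN₂ θ₂)
    (h : N₁ →ₗ[PowerSeries k] N₂)
    (hh : IsMFMorphism k N₁ N₂ N₁1 N₂1 φN₁ φN₂ h) :
    ∃! f : M₁ →ₗ[PowerSeries k] M₂,
      IsMFMorphism k M₁ M₂ M₁1 M₂1 φM₁ φM₂ f ∧ θ₂ ∘ₗ f = h ∘ₗ θ₁ := by
  classical
  have := hM₁.2.1
  have := hM₁.2.2.1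
  have := hM₂.2.1
  have := hM₂.2.2.1
  obtain ⟨⟨hmor₁, hsurj₁, hmap₁, hker₁⟩, -⟩ := And.intro hθ₁ trivial
  obtain ⟨⟨hmor₂, hsurj₂, hmap₂, hker₂⟩, hnil⟩ := hθ₂
  obtain ⟨hφa₁, hφs₁⟩ := hM₁.1
  obtain ⟨hφa₂, hφs₂⟩ := hM₂.1
  have hφ0N : φN₂ 0 = 0 := by
    have := hN₂.2 0 0 (Submodule.zero_mem _)
    simpa using this
  have hφneg₂ : ∀ a ∈ M₂1, φM₂ (-a) = - φM₂ a := by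
    intro a ha
    have h0 : φM₂ 0 = 0 := by simpa using hφs₂ 0 0 (Submodule.zero_mem _)
    have := hφa₂ a ha (-a) (Submodule.neg_mem _ ha)
    rw [add_neg_cancel, h0] at this
    exact (neg_eq_of_add_eq_zero_right this.symm).symm
  have hφker : ∀ x ∈ LinearMap.ker θ₂, φM₂ x ∈ LinearMap.ker θ₂ := by
    intro x hx
    rw [LinearMap.mem_ker, hmor₂.2 x (hker₂ hx), LinearMap.mem_ker.1 hx, hφ0N]
  -- the kernel `T` with its semilinear operator
  let φT : LinearMap.ker θ₂ →+ LinearMap.ker θ₂ :=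
    AddMonoidHom.mk' (fun x => ⟨φM₂ x, hφker x x.2⟩)
      (fun x y => Subtype.ext (hφa₂ x (hker₂ x.2) y (hker₂ y.2)))
  have hφTval : ∀ x, (φT x : M₂) = φM₂ x := fun _ => rfl
  have hφT : ∀ (s : PowerSeries k) x, φT (s • x) = s ^ 2 • φT x := fun s x =>
    Subtype.ext (hφs₂ s x (hker₂ x.2))
  have hφTit : ∀ (n : ℕ) x, ((φT^[n] x : LinearMap.ker θ₂) : M₂) = φM₂^[n] x := by
    intro n
    induction n with
    | zero => intro x; rfl
    | succ n ih => intro x; rw [Function.iterate_succ_apply, ih, Function.iterate_succ_apply]; rfl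
  have hnilT := PhiLiftAux.nilp_aux k (LinearMap.ker θ₂) φT hφT (by
    intro x hx
    have : (x : M₂) ∈ (⋂ n : ℕ, φM₂^[n] '' (LinearMap.ker θ₂ : Set M₂)) := by
      rw [Set.mem_iInter]
      intro n
      obtain ⟨y, hy⟩ := hx n
      exact ⟨y, y.2, by rw [← hφTit, hy]⟩
    rw [hnil] at this
    exact Subtype.ext this)
  -- an arbitrary linear lift
  obtain ⟨f₀, hf₀⟩ := Module.projective_lifting_property θ₂ (h ∘ₗ θ₁) hsurj₂
  have hlift : ∀ f : M₁ →ₗ[PowerSeries k] M₂, θ₂ ∘ₗ f = h ∘ₗ θ₁ → ∀ a ∈ M₁1, f a ∈ M₂1 := by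
    intro f hf a ha
    have h1 : θ₂ (f a) = h (θ₁ a) := LinearMap.congr_fun hf a
    have h2 : h (θ₁ a) ∈ N₂1 :=
      hh.1 (Submodule.mem_map_of_mem (hmor₁.1 (Submodule.mem_map_of_mem ha)))
    rw [← hmap₂] at h2
    obtain ⟨c, hc, hc2⟩ := h2
    have h3 : f a - c ∈ LinearMap.ker θ₂ := by
      rw [LinearMap.mem_ker, map_sub, h1, hc2, sub_self]
    have := Submodule.add_mem _ (hker₂ h3) hc
    simpa using this
  have hf₀M := hlift f₀ hf₀
  have hδ : ∀ a : M₁, ∃ x : LinearMap.ker θ₂, a ∈ M₁1 → (x : M₂) = φM₂ (f₀ a) - f₀ (φM₁ a) := by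
    intro a
    by_cases ha : a ∈ M₁1
    · refine ⟨⟨φM₂ (f₀ a) - f₀ (φM₁ a), ?_⟩, fun _ => rfl⟩
      have e1 : θ₂ (f₀ a) = h (θ₁ a) := LinearMap.congr_fun hf₀ a
      have e2 : θ₂ (f₀ (φM₁ a)) = h (θ₁ (φM₁ a)) := LinearMap.congr_fun hf₀ _
      rw [LinearMap.mem_ker, map_sub, hmor₂.2 _ (hf₀M a ha), e1, e2, hmor₁.2 a ha,
        hh.2 _ (hmor₁.1 (Submodule.mem_map_of_mem ha)), sub_self]
    · exact ⟨0, fun h => absurd h ha⟩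
  choose δ hδ using hδ
  obtain ⟨u, hu, huniq⟩ := PhiLiftAux.hom_aux k e M₁ M₁1 φM₁ hM₁ (LinearMap.ker θ₂) φT hφT hnilT δ
    (by
      intro a ha b hb
      apply Subtype.ext
      rw [Submodule.coe_add, hδ _ (Submodule.add_mem _ ha hb), hδ a ha, hδ b hb, map_add,
        hφa₂ _ (hf₀M a ha) _ (hf₀M b hb), hφa₁ a ha b hb, map_add]
      abel)
    (by
      intro s a ha
      apply Subtype.ext
      rw [Submodule.coe_smul, hδ _ (Submodule.smul_mem _ s ha), hδ a ha, map_smul,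
        hφs₂ s _ (hf₀M a ha), hφs₁ s a ha, map_smul, smul_sub])
  refine ⟨f₀ + (LinearMap.ker θ₂).subtype ∘ₗ u, ?_, ?_⟩
  · have hcomp : θ₂ ∘ₗ (f₀ + (LinearMap.ker θ₂).subtype ∘ₗ u) = h ∘ₗ θ₁ := by
      rw [← hf₀]
      ext m
      simp
    refine ⟨⟨?_, ?_⟩, hcomp⟩
    · rintro _ ⟨a, ha, rfl⟩
      exact hlift _ hcomp a ha
    · intro a ha
      have h1 : ((u (φM₁ a) : LinearMap.ker θ₂) : M₂) = φM₂ (u a) + (φM₂ (f₀ a) - f₀ (φM₁ a)) := by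
        rw [hu a ha, Submodule.coe_add, hδ a ha, hφTval]
      simp only [LinearMap.add_apply, LinearMap.comp_apply, Submodule.subtype_apply]
      rw [h1, hφa₂ _ (hf₀M a ha) _ (hker₂ (u a).2)]
      abel
  · rintro f ⟨⟨hf1, hf2⟩, hf3⟩
    have hmem : ∀ m, (f - f₀) m ∈ LinearMap.ker θ₂ := by
      intro m
      have e1 : θ₂ (f₀ m) = h (θ₁ m) := LinearMap.congr_fun hf₀ m
      have e2 : θ₂ (f m) = h (θ₁ m) := LinearMap.congr_fun hf3 m
      rw [LinearMap.mem_ker, LinearMap.sub_apply, map_sub, e1, e2, sub_self]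
    have hv := huniq ((f - f₀).codRestrict _ hmem) (by
      intro a ha
      apply Subtype.ext
      rw [Submodule.coe_add, hδ a ha, hφTval]
      simp only [LinearMap.codRestrict_apply, LinearMap.sub_apply]
      rw [hf2 a ha, sub_eq_add_neg (f a), hφa₂ _ (hlift f hf3 a ha) _
        (Submodule.neg_mem _ (hf₀M a ha)), hφneg₂ _ (hf₀M a ha)]
      abel)
    rw [← hv]
    ext m
    simp
end

section
/- Let (N⁰, N¹, φ₁) be an object of 𝓜𝓕_S and let θ : (M⁰, M¹, φ₁) → (N⁰, N¹, φ₁) and θ' : (M'⁰, M'¹, φ₁) → (N⁰, N¹, φ₁) be nilpotent φ₁-lifts, where (M⁰, M¹, φ₁) and (M'⁰, M'¹, φ₁) are objects of MF^e_S. Then there is a unique isomorphism g : (M⁰, M¹, φ₁) → (M'⁰, M'¹, φ₁) in MF^e_S with θ' ∘ g = θ. -/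
namespace PhiLiftAux

open PowerSeries

lemma end_mul_apply {L : Type} [AddCommGroup L] (f g : AddMonoid.End L) (x : L) :
    (f * g) x = f (g x) := rfl

lemma end_add_apply {L : Type} [AddCommGroup L] (f g : AddMonoid.End L) (x : L) :
    (f + g) x = f x + g x := rfl

section Complete

variable {k : Type} [Field k] {L : Type} [AddCommGroup L] [Module (PowerSeries k) L]
  [Module.Free (PowerSeries k) L] [Module.Finite (PowerSeries k) L]

/-- Separatedness of a finite free module. -/
lemma eq_zero_of_forall (x : L)
    (h : ∀ n : ℕ, ∃ y : L, x = (X : PowerSeries k) ^ n • y) : x = 0 := by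
  let b := Module.Free.chooseBasis (PowerSeries k) L
  apply b.ext_elem
  intro i
  ext j
  obtain ⟨y, hy⟩ := h (j + 1)
  rw [hy]
  simp only [map_smul, Finsupp.smul_apply, smul_eq_mul, map_zero, Finsupp.coe_zero,
    Pi.zero_apply]
  rw [PowerSeries.coeff_X_pow_mul', if_neg (by omega)]

/-- Completeness of a finite free module. -/
lemma exists_limit (x : ℕ → L)
    (h : ∀ n : ℕ, ∃ y : L, x (n + 1) - x n = (X : PowerSeries k) ^ n • y) :
    ∃ z : L, ∀ n : ℕ, ∃ y : L, z - x n = (X : PowerSeries k) ^ n • y := by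
  let b := Module.Free.chooseBasis (PowerSeries k) L
  have hst : ∀ i (j n m : ℕ), j < n →
      coeff j (b.repr (x (n + m)) i) = coeff j (b.repr (x n) i) := by
    intro i j n m hj
    induction m with
    | zero => rfl
    | succ m ih =>
      obtain ⟨y, hy⟩ := h (n + m)
      have h2 : x (n + (m + 1)) = x (n + m) + (X : PowerSeries k) ^ (n + m) • y := by
        rw [← hy, ← add_assoc]; abel
      rw [h2, map_add, map_smul, Finsupp.add_apply, map_add, ih, Finsupp.smul_apply,
        smul_eq_mul, PowerSeries.coeff_X_pow_mul', if_neg (by omega), add_zero]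
  let c : _ → PowerSeries k := fun i => PowerSeries.mk fun j => coeff j (b.repr (x (j + 1)) i)
  refine ⟨b.equivFun.symm c, fun n => ?_⟩
  have hd : ∀ i, (X : PowerSeries k) ^ n ∣ c i - b.repr (x n) i := by
    intro i
    rw [PowerSeries.X_pow_dvd_iff]
    intro j hj
    obtain ⟨m, rfl⟩ := Nat.exists_eq_add_of_lt hj
    have := hst i j (j + 1) m (by omega)
    simp only [c, map_sub, PowerSeries.coeff_mk]
    rw [← this, show j + m + 1 = j + 1 + m by ring, sub_self]
  choose q hq using hd
  refine ⟨b.equivFun.symm q, ?_⟩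
  apply b.ext_elem
  intro i
  rw [map_sub, map_smul, Finsupp.sub_apply, Finsupp.smul_apply, smul_eq_mul,
    ← b.equivFun_apply, ← b.equivFun_apply, ← b.equivFun_apply,
    LinearEquiv.apply_symm_apply, LinearEquiv.apply_symm_apply, b.equivFun_apply]
  exact hq i

/-- `1 - A` is bijective for a topologically nilpotent `A`. -/
lemma one_sub_bijective (A : AddMonoid.End L)
    (hA : ∀ (n : ℕ) (x : L), ∃ y : L,
      A ((X : PowerSeries k) ^ n • x) = (X : PowerSeries k) ^ (n + 1) • y) :
    Function.Bijective (1 - A : AddMonoid.End L) := by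
  have hpow : ∀ (n : ℕ) (x : L), ∃ y, (A ^ n) x = (X : PowerSeries k) ^ n • y := by
    intro n x
    induction n with
    | zero => exact ⟨x, by simp⟩
    | succ n ih =>
      obtain ⟨y, hy⟩ := ih
      rw [pow_succ', end_mul_apply, hy]
      exact hA n y
  constructor
  · rw [injective_iff_map_eq_zero]
    intro x hx
    have hx' : A x = x := by
      have : x - A x = 0 := hx
      exact (sub_eq_zero.mp this).symm
    have hxn : ∀ n : ℕ, (A ^ n) x = x := by
      intro n
      induction n with
      | zero => simp
      | succ n ih => rw [pow_succ', end_mul_apply, ih, hx']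
    apply eq_zero_of_forall (k := k)
    intro n
    obtain ⟨y, hy⟩ := hpow n x
    exact ⟨y, by rw [← hy, hxn]⟩
  · intro h0
    let S : ℕ → AddMonoid.End L := fun n => ∑ i ∈ Finset.range n, A ^ i
    obtain ⟨z, hz⟩ := exists_limit (k := k) (fun n => S n h0) (by
      intro n
      obtain ⟨y, hy⟩ := hpow n h0
      refine ⟨y, ?_⟩
      rw [← hy]
      simp only [S, Finset.sum_range_succ, end_add_apply]
      abel)
    refine ⟨z, ?_⟩
    rw [← sub_eq_zero]
    apply eq_zero_of_forall (k := k)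
    intro n
    obtain ⟨y, hy⟩ := hz n
    obtain ⟨y1, hy1⟩ := hA n y
    obtain ⟨y2, hy2⟩ := hpow n h0
    have hg : (1 - A) (S n h0) = h0 - (A ^ n) h0 := by
      have := congrArg (fun f : AddMonoid.End L => f h0) (mul_neg_geom_sum A n)
      exact this
    have hzz : z = S n h0 + (X : PowerSeries k) ^ n • y := by rw [← hy]; abel
    refine ⟨y - (X : PowerSeries k) • y1 - y2, ?_⟩
    have : (1 - A) ((X : PowerSeries k) ^ n • y) =
        (X : PowerSeries k) ^ n • y - (X : PowerSeries k) ^ (n + 1) • y1 := by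
      rw [← hy1]; rfl
    rw [hzz, map_add, hg, this, hy2, smul_sub, smul_sub, smul_smul, ← pow_succ]
    abel

end Complete

section Nilp

variable {k : Type} [Field k] {T : Type} [AddCommGroup T] [Module (PowerSeries k) T]

lemma iterate_smul (φ : AddMonoid.End T) (hφ : ∀ (s : PowerSeries k) x, φ (s • x) = s ^ 2 • φ x)
    (n : ℕ) (s : PowerSeries k) (x : T) : (φ ^ n) (s • x) = s ^ (2 ^ n) • (φ ^ n) x := by
  induction n with
  | zero => simp
  | succ n ih =>
    rw [pow_succ', end_mul_apply, ih, hφ, end_mul_apply, ← pow_mul,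
      ← pow_succ]

/-- The submodule `φⁿ(T) + tT`. -/
def imgSub [IsAlgClosed k] (φ : AddMonoid.End T)
    (hφ : ∀ (s : PowerSeries k) x, φ (s • x) = s ^ 2 • φ x) (n : ℕ) :
    Submodule (PowerSeries k) T where
  carrier := {x | ∃ y z : T, x = (φ ^ n) y + (X : PowerSeries k) • z}
  zero_mem' := ⟨0, 0, by simp⟩
  add_mem' := by
    rintro _ _ ⟨y, z, rfl⟩ ⟨y', z', rfl⟩
    exact ⟨y + y', z + z', by rw [map_add, smul_add]; abel⟩
  smul_mem' := by
    rintro s _ ⟨y, z, rfl⟩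
    obtain ⟨c, hc⟩ := IsAlgClosed.exists_pow_nat_eq (constantCoeff s) (pow_pos two_pos n)
    have hd : (X : PowerSeries k) ∣ s - (C c) ^ (2 ^ n) := by
      rw [PowerSeries.X_dvd_iff]
      simp [hc]
    obtain ⟨q, hq⟩ := hd
    refine ⟨C c • y, q • (φ ^ n) y + s • z, ?_⟩
    have hs : s = (C c) ^ (2 ^ n) + X * q := by rw [← hq]; ring
    rw [iterate_smul φ hφ]
    conv_lhs => rw [smul_add, smul_comm s (X : PowerSeries k) z]
    rw [smul_add, smul_smul X q, ← add_assoc, ← add_smul, ← hs]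

variable [Module.Free (PowerSeries k) T] [Module.Finite (PowerSeries k) T]

lemma quot_artinian : IsArtinian (PowerSeries k)
    (T ⧸ (Ideal.span {(X : PowerSeries k)} • (⊤ : Submodule (PowerSeries k) T))) := by
  have : IsArtinianRing (PowerSeries k ⧸ Ideal.span {(X: PowerSeries k)}) := by
    have : (Ideal.span {(X: PowerSeries k)}).IsMaximal := by
      rw [← PowerSeries.maximalIdeal_eq_span_X]
      infer_instance
    let _ := Ideal.Quotient.field (Ideal.span {(X: PowerSeries k)})
    infer_instance
  exact isArtinian_of_surjective_algebraMap
    (R := PowerSeries k ⧸ Ideal.span {(X: PowerSeries k)}) Ideal.Quotient.mk_surjective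

/-- A semilinear `φ` with `⋂ φⁿ(T) = 0` is nilpotent modulo `t`. -/
lemma exists_nilp [IsAlgClosed k] (φ : AddMonoid.End T)
    (hφ : ∀ (s : PowerSeries k) x, φ (s • x) = s ^ 2 • φ x)
    (hnil : ∀ x : T, (∀ n : ℕ, ∃ y, (φ ^ n) y = x) → x = 0) :
    ∃ d : ℕ, ∀ x : T, ∃ y : T, (φ ^ d) x = (X : PowerSeries k) • y := by
  let R := imgSub φ hφ
  let K : Submodule (PowerSeries k) T :=
    Ideal.span {(X : PowerSeries k)} • (⊤ : Submodule (PowerSeries k) T)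
  have hK : ∀ x, x ∈ K ↔ ∃ z : T, x = (X : PowerSeries k) • z := by
    intro x
    simp only [K]
    rw [Submodule.ideal_span_singleton_smul, Submodule.mem_smul_pointwise_iff_exists]
    constructor
    · rintro ⟨z, -, rfl⟩; exact ⟨z, rfl⟩
    · rintro ⟨z, rfl⟩; exact ⟨z, trivial, rfl⟩
  have hKR : ∀ n, K ≤ R n := by
    intro n x hx
    obtain ⟨z, rfl⟩ := (hK x).1 hx
    exact ⟨0, z, by simp⟩
  have hanti : Antitone R := by
    apply antitone_nat_of_succ_le
    rintro n _ ⟨y, z, rfl⟩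
    exact ⟨φ y, z, by rw [pow_succ, end_mul_apply]⟩
  have : IsArtinian (PowerSeries k) (T ⧸ K) := quot_artinian
  obtain ⟨d, hd⟩ := IsArtinian.monotone_stabilizes (R := PowerSeries k) (M := T ⧸ K)
    ⟨fun n => OrderDual.toDual ((R n).map K.mkQ), fun a b hab =>
      Submodule.map_mono (hanti hab)⟩
  have hd1 : R d ≤ R (d + 1) := by
    have h1 : (R d).map K.mkQ = (R (d + 1)).map K.mkQ := hd (d + 1) (by omega)
    have h2 := congrArg (Submodule.comap K.mkQ) h1
    rw [Submodule.comap_map_mkQ, Submodule.comap_map_mkQ, sup_eq_right.2 (hKR _),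
      sup_eq_right.2 (hKR _)] at h2
    exact h2.le
  refine ⟨d, ?_⟩
  by_contra! hcon
  obtain ⟨x, hx⟩ := hcon
  have hstep : ∀ w : R d, ∃ w' : R d, ∃ z : T, φ w' - w = (X : PowerSeries k) • z := by
    rintro ⟨w, hw⟩
    obtain ⟨y, z, rfl⟩ := hd1 hw
    refine ⟨⟨(φ ^ d) y, y, 0, by simp⟩, -z, ?_⟩
    simp only [pow_succ', end_mul_apply]
    rw [smul_neg]
    abel
  choose nxt hnxt using hstep
  let w : ℕ → R d := fun n => nxt^[n] ⟨(φ ^ d) x, x, 0, by simp⟩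
  have hw : ∀ n, ∃ z : T, φ (w (n + 1)) - w n = (X : PowerSeries k) • z := by
    intro n
    simp only [w, Function.iterate_succ_apply']
    exact hnxt _
  have hlim : ∀ j : ℕ, ∃ v : T, ∀ n : ℕ, ∃ y : T,
      v - (φ ^ n) (w (n + j)) = (X : PowerSeries k) ^ n • y := by
    intro j
    apply exists_limit (fun n => (φ ^ n) (w (n + j) : T))
    intro n
    obtain ⟨z, hz⟩ := hw (n + j)
    refine ⟨(X : PowerSeries k) ^ (2 ^ n - n) • (φ ^ n) z, ?_⟩
    rw [smul_smul, ← pow_add, Nat.add_sub_cancel' Nat.lt_two_pow_self.le,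
      ← iterate_smul φ hφ, ← hz, map_sub, pow_succ, end_mul_apply,
      show n + 1 + j = n + j + 1 by ring]
  choose v hv using hlim
  have hvs : ∀ j, φ (v (j + 1)) = v j := by
    intro j
    rw [← sub_eq_zero]
    apply eq_zero_of_forall (k := k)
    intro n
    obtain ⟨y, hy⟩ := hv (j + 1) n
    obtain ⟨y', hy'⟩ := hv j (n + 1)
    refine ⟨(X : PowerSeries k) ^ n • φ y - (X : PowerSeries k) • y', ?_⟩
    have e1 : φ (v (j + 1)) - (φ ^ (n + 1)) (w (n + (j + 1))) =
        ((X : PowerSeries k) ^ n) ^ 2 • φ y := by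
      rw [← hφ, ← hy, map_sub, pow_succ', end_mul_apply]
    rw [show n + 1 + j = n + (j + 1) by ring] at hy'
    have e2 : φ (v (j + 1)) - v j = (φ (v (j + 1)) - (φ ^ (n + 1)) (w (n + (j + 1)))) -
      (v j - (φ ^ (n + 1)) (w (n + (j + 1)))) := by abel
    rw [e2, e1, hy', smul_sub, smul_smul, smul_smul, ← pow_succ, sq]
  have hvn : ∀ n, (φ ^ n) (v n) = v 0 := by
    intro n
    induction n with
    | zero => simp
    | succ n ih => rw [pow_succ, end_mul_apply, hvs, ih]
  have hv0 : v 0 = 0 := hnil _ fun n => ⟨v n, hvn n⟩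
  obtain ⟨y, hy⟩ := hv 0 1
  obtain ⟨z, hz⟩ := hw 0
  apply hx (-(y + z))
  have hw0 : (w 0 : T) = (φ ^ d) x := rfl
  rw [← hw0, smul_neg, smul_add, ← hz]
  rw [hv0, pow_one, pow_one, zero_sub] at hy
  rw [← hy]
  simp

end Nilp

section Main

variable {k : Type} [Field k]
  {M : Type} [AddCommGroup M] [Module (PowerSeries k) M]

lemma phi_sum {M1 : Submodule (PowerSeries k) M} {φ : M → M} (h : IsMFTriple k M M1 φ)
    {ι : Type} (I : Finset ι) (s : ι → PowerSeries k) (b : ι → M1) :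
    φ (∑ i ∈ I, s i • (b i : M)) = ∑ i ∈ I, s i ^ 2 • φ (b i) := by
  classical
  induction I using Finset.induction_on with
  | empty =>
    have := h.2 0 0 M1.zero_mem
    simpa using this
  | insert a I ha ih =>
    rw [Finset.sum_insert ha, Finset.sum_insert ha, h.1, h.2 _ _ (b a).2, ih]
    · exact M1.smul_mem _ (b a).2
    · exact M1.sum_mem fun i _ => M1.smul_mem _ (b i).2

lemma exists_bases {e : ℕ} {M1 : Submodule (PowerSeries k) M} {φ : M → M}
    (h : IsMFeTriple k e M M1 φ) :
    ∃ (n : ℕ) (b : Module.Basis (Fin n) (PowerSeries k) M1)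
      (B : Module.Basis (Fin n) (PowerSeries k) M), ∀ i, B i = φ (b i) := by
  obtain ⟨h0, hfree, hfin, ht, hspan⟩ := h
  let b := Module.finBasis (PowerSeries k) M1
  have hr : Module.finrank (PowerSeries k) M1 = Module.finrank (PowerSeries k) M := by
    apply le_antisymm
    · exact LinearMap.finrank_le_finrank_of_injective M1.injective_subtype
    · let f : M →ₗ[PowerSeries k] M1 :=
        LinearMap.codRestrict M1 (LinearMap.lsmul (PowerSeries k) M
          ((X : PowerSeries k) ^ e)) ht
      apply LinearMap.finrank_le_finrank_of_injective (f := f)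
      intro x y hxy
      have h1 : (X : PowerSeries k) ^ e • x = (X : PowerSeries k) ^ e • y :=
        congrArg Subtype.val hxy
      exact smul_right_injective M (pow_ne_zero e PowerSeries.X_ne_zero) h1
  have htop : ⊤ ≤ Submodule.span (PowerSeries k) (Set.range fun i => φ (b i)) := by
    rw [← hspan, Submodule.span_le]
    rintro _ ⟨a, ha, rfl⟩
    have h1 : a = ∑ i, b.repr ⟨a, ha⟩ i • (b i : M) := by
      have := congrArg M1.subtype (b.sum_repr ⟨a, ha⟩)
      rw [map_sum] at this
      exact this.symm
    rw [h1, phi_sum h0]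
    exact Submodule.sum_mem _ fun i _ => Submodule.smul_mem _ _
      (Submodule.subset_span ⟨i, rfl⟩)
  have hli := linearIndependent_of_top_le_span_of_card_eq_finrank htop (by simpa using hr)
  exact ⟨_, b, Module.Basis.mk hli htop, fun i => by simp⟩

variable {T : Type} [AddCommGroup T] [Module (PowerSeries k) T]

/-- The operator on `Hom(M, T) = Tⁿ`. -/
noncomputable def psi {n : ℕ} (B : Module.Basis (Fin n) (PowerSeries k) M) (c : Fin n → M)
    (φ : AddMonoid.End T) : AddMonoid.End (Fin n → T) where
  toFun v := fun i => φ (B.constr (PowerSeries k) v (c i))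
  map_zero' := by ext i; simp
  map_add' v w := by ext i; simp

lemma psi_apply {n : ℕ} (B : Module.Basis (Fin n) (PowerSeries k) M) (c : Fin n → M)
    (φ : AddMonoid.End T) (v : Fin n → T) (i : Fin n) :
    psi B c φ v i = φ (B.constr (PowerSeries k) v (c i)) := rfl

lemma constr_mem {n : ℕ} (B : Module.Basis (Fin n) (PowerSeries k) M) (v : Fin n → T)
    (K : Submodule (PowerSeries k) T) (hv : ∀ i, v i ∈ K) (x : M) :
    B.constr (PowerSeries k) v x ∈ K := by
  rw [B.constr_apply_fintype (PowerSeries k)]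
  exact K.sum_mem fun i _ => K.smul_mem _ (hv i)

lemma psi_bijective [IsAlgClosed k] [Module.Free (PowerSeries k) T]
    [Module.Finite (PowerSeries k) T]
    {n : ℕ} (B : Module.Basis (Fin n) (PowerSeries k) M) (c : Fin n → M)
    (φ : AddMonoid.End T)
    (hφ : ∀ (s : PowerSeries k) x, φ (s • x) = s ^ 2 • φ x)
    (hnil : ∀ x : T, (∀ n : ℕ, ∃ y, (φ ^ n) y = x) → x = 0) :
    Function.Bijective (1 - psi B c φ : AddMonoid.End (Fin n → T)) := by
  obtain ⟨d, hd⟩ := exists_nilp φ hφ hnil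
  set Ψ := psi B c φ with hΨ
  have hsemi : ∀ (s : PowerSeries k) x, Ψ (s • x) = s ^ 2 • Ψ x := by
    intro s x
    ext i
    rw [Pi.smul_apply, hΨ, psi_apply, psi_apply, map_smul, LinearMap.smul_apply, hφ]
  let P : ℕ → Submodule (PowerSeries k) T := fun m =>
    Submodule.span (PowerSeries k) (Set.range (φ ^ m))
  have hPstep : ∀ m, ∀ x ∈ P m, φ x ∈ P (m + 1) := by
    intro m x hx
    induction hx using Submodule.span_induction with
    | mem x hx =>
      obtain ⟨y, rfl⟩ := hx
      exact Submodule.subset_span ⟨y, by rw [pow_succ', end_mul_apply]⟩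
    | zero => simp
    | add x y _ _ hx hy => rw [map_add]; exact add_mem hx hy
    | smul s x _ hx => rw [hφ]; exact Submodule.smul_mem _ _ hx
  have hmem : ∀ m (v : Fin n → T) i, (Ψ ^ m) v i ∈ P m := by
    intro m v
    induction m with
    | zero => intro i; exact Submodule.subset_span ⟨v i, rfl⟩
    | succ m ih =>
      intro i
      rw [pow_succ', end_mul_apply]
      exact hPstep m _ (constr_mem B _ _ ih _)
  have hPd : ∀ x ∈ P d, ∃ y : T, x = (X : PowerSeries k) • y := by
    intro x hx
    induction hx using Submodule.span_induction with
    | mem x hx => obtain ⟨y, rfl⟩ := hx; exact hd y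
    | zero => exact ⟨0, by simp⟩
    | add x y _ _ hx hy =>
      obtain ⟨x', rfl⟩ := hx
      obtain ⟨y', rfl⟩ := hy
      exact ⟨x' + y', by rw [smul_add]⟩
    | smul s x _ hx =>
      obtain ⟨x', rfl⟩ := hx
      exact ⟨s • x', by rw [smul_comm]⟩
  have hbij : Function.Bijective (1 - Ψ ^ d : AddMonoid.End (Fin n → T)) := by
    apply one_sub_bijective (k := k)
    intro m v
    have h1 : ∀ i, ∃ y : T, (Ψ ^ d) v i = (X : PowerSeries k) • y := fun i =>
      hPd _ (hmem d v i)
    choose q hq using h1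
    have hq' : (Ψ ^ d) v = (X : PowerSeries k) • q := funext hq
    have hle : m ≤ m * 2 ^ d := Nat.le_mul_of_pos_right _ (by positivity)
    refine ⟨(X : PowerSeries k) ^ (m * 2 ^ d - m) • q, ?_⟩
    rw [iterate_smul Ψ hsemi, hq', smul_smul, smul_smul, ← pow_mul, ← pow_succ, ← pow_add]
    congr 2
    omega
  constructor
  · have h2 : (∑ i ∈ Finset.range d, Ψ ^ i) * (1 - Ψ) = 1 - Ψ ^ d := geom_sum_mul_neg Ψ d
    rw [← h2] at hbij
    exact Function.Injective.of_comp
      (f := (∑ i ∈ Finset.range d, Ψ ^ i : AddMonoid.End (Fin n → T))) hbij.1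
  · have h2 := mul_neg_geom_sum Ψ d
    rw [← h2] at hbij
    exact Function.Surjective.of_comp
      (g := (∑ i ∈ Finset.range d, Ψ ^ i : AddMonoid.End (Fin n → T))) hbij.2

/-- The restriction of `φ₁` to the kernel. -/
lemma exists_phiT {M' N : Type} [AddCommGroup M'] [Module (PowerSeries k) M']
    [AddCommGroup N] [Module (PowerSeries k) N]
    {M'1 : Submodule (PowerSeries k) M'} {N1 : Submodule (PowerSeries k) N}
    {φM' : M' → M'} {φN : N → N}
    (hM' : IsMFTriple k M' M'1 φM') (hN : IsMFTriple k N N1 φN)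
    {θ' : M' →ₗ[PowerSeries k] N}
    (hθ' : IsNilpotentPhiLift k M' N M'1 N1 φM' φN θ') :
    ∃ φ : AddMonoid.End (LinearMap.ker θ'),
      (∀ x, (φ x : M') = φM' x) ∧
      (∀ (s : PowerSeries k) x, φ (s • x) = s ^ 2 • φ x) ∧
      (∀ x, (∀ n : ℕ, ∃ y, (φ ^ n) y = x) → x = 0) := by
  obtain ⟨⟨⟨-, hcomm⟩, -, -, hker⟩, hnil⟩ := hθ'
  have hN0 : φN 0 = 0 := by simpa using hN.2 0 0 N1.zero_mem
  have hM0 : φM' 0 = 0 := by simpa using hM'.2 0 0 M'1.zero_mem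
  have hmem : ∀ x ∈ LinearMap.ker θ', φM' x ∈ LinearMap.ker θ' := by
    intro x hx
    rw [LinearMap.mem_ker, hcomm x (hker hx), LinearMap.mem_ker.1 hx, hN0]
  let φ : AddMonoid.End (LinearMap.ker θ') :=
    { toFun := fun x => ⟨φM' x, hmem x x.2⟩
      map_zero' := Subtype.ext hM0
      map_add' := fun x y => Subtype.ext (hM'.1 _ (hker x.2) _ (hker y.2)) }
  have hφ : ∀ x, (φ x : M') = φM' x := fun x => rfl
  refine ⟨φ, hφ, fun s x => Subtype.ext (hM'.2 s x (hker x.2)), fun x hx => ?_⟩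
  have hit : ∀ (n : ℕ) y, ((φ ^ n) y : M') = φM'^[n] y := by
    intro n y
    induction n with
    | zero => rfl
    | succ n ih => rw [pow_succ', end_mul_apply, hφ, ih, Function.iterate_succ_apply']
  have : (x : M') ∈ (⋂ n : ℕ, φM'^[n] '' (LinearMap.ker θ' : Set M')) := by
    rw [Set.mem_iInter]
    intro n
    obtain ⟨y, rfl⟩ := hx n
    exact ⟨y, y.2, (hit n y).symm⟩
  rw [hnil] at this
  exact Subtype.ext this

lemma exists_unique_hom [IsAlgClosed k] {e : ℕ} {M' N : Type} [AddCommGroup M']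
    [Module (PowerSeries k) M'] [AddCommGroup N] [Module (PowerSeries k) N]
    {M1 : Submodule (PowerSeries k) M}
    {M'1 : Submodule (PowerSeries k) M'} {N1 : Submodule (PowerSeries k) N}
    {φM : M → M} {φM' : M' → M'} {φN : N → N}
    (hM : IsMFeTriple k e M M1 φM) (hM' : IsMFeTriple k e M' M'1 φM')
    (hN : IsMFTriple k N N1 φN)
    {θ : M →ₗ[PowerSeries k] N} {θ' : M' →ₗ[PowerSeries k] N}
    (hθ : IsNilpotentPhiLift k M N M1 N1 φM φN θ)
    (hθ' : IsNilpotentPhiLift k M' N M'1 N1 φM' φN θ') :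
    (∃ g : M →ₗ[PowerSeries k] M', (∀ a ∈ M1, g a ∈ M'1) ∧
      (∀ a ∈ M1, g (φM a) = φM' (g a)) ∧ θ' ∘ₗ g = θ) ∧
    (∀ g g' : M →ₗ[PowerSeries k] M',
      (∀ a ∈ M1, g (φM a) = φM' (g a)) → θ' ∘ₗ g = θ →
      (∀ a ∈ M1, g' (φM a) = φM' (g' a)) → θ' ∘ₗ g' = θ → g = g') := by
  obtain ⟨n, b, B, hB⟩ := exists_bases hM
  obtain ⟨φ, hφ, hsemi, hnil⟩ := exists_phiT hM'.1 hN hθ'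
  obtain ⟨hM0, hfree, hfin, -, -⟩ := hM
  obtain ⟨hM'0, hfree', hfin', -, -⟩ := hM'
  obtain ⟨⟨⟨hle, hcomm⟩, -, hmap, hker⟩, -⟩ := hθ
  obtain ⟨⟨⟨hle', hcomm'⟩, hsurj', hmap', hker'⟩, -⟩ := hθ'
  have hfil : ∀ g : M →ₗ[PowerSeries k] M', θ' ∘ₗ g = θ → ∀ a ∈ M1, g a ∈ M'1 := by
    intro g hg a ha
    have h1 : θ' (g a) = θ a := LinearMap.congr_fun hg a
    have h2 : θ a ∈ M'1.map θ' := by rw [hmap', ← hmap]; exact ⟨a, ha, rfl⟩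
    obtain ⟨c, hc, hc'⟩ := h2
    have h3 : g a - c ∈ M'1 := hker' (by
      rw [LinearMap.mem_ker, map_sub, h1, hc', sub_self])
    have := M'1.add_mem h3 hc
    simpa using this
  have hbij := psi_bijective (T := LinearMap.ker θ') B (fun i => (b i : M)) φ hsemi hnil
  constructor
  · obtain ⟨g0, hg0⟩ := Module.projective_lifting_property θ' θ hsurj'
    have hg0' : ∀ x, θ' (g0 x) = θ x := fun x => LinearMap.congr_fun hg0 x
    have hu : ∀ i, φM' (g0 (b i)) - g0 (B i) ∈ LinearMap.ker θ' := by
      intro i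
      rw [LinearMap.mem_ker, map_sub, hcomm' _ (hfil g0 hg0 _ (b i).2), hg0', hg0', hB,
        hcomm _ (b i).2, sub_self]
    obtain ⟨v, hv⟩ := hbij.2 (fun i => ⟨_, hu i⟩)
    let h : M →ₗ[PowerSeries k] LinearMap.ker θ' := B.constr (PowerSeries k) v
    let g : M →ₗ[PowerSeries k] M' := g0 + (LinearMap.ker θ').subtype ∘ₗ h
    have hg : ∀ x, g x = g0 x + (h x : M') := fun x => rfl
    have hgl : θ' ∘ₗ g = θ := by
      ext x
      rw [LinearMap.comp_apply, hg, map_add, hg0', LinearMap.mem_ker.1 (h x).2, add_zero]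
    have hgb : ∀ i, g (B i) = φM' (g (b i)) := by
      intro i
      have h1 : v i - φ (h (b i)) = ⟨_, hu i⟩ := congrFun hv i
      have h2 : (v i : M') - φM' (h (b i)) = φM' (g0 (b i)) - g0 (B i) := by
        have := congrArg Subtype.val h1
        rw [← hφ]
        exact this
      rw [hg, hg, hM'0.1 _ (hfil g0 hg0 _ (b i).2) _ (hker' (h (b i)).2)]
      have h3 : h (B i) = v i := B.constr_basis _ _ _
      rw [h3, ← sub_eq_zero]
      rw [← sub_eq_zero] at h2
      rw [← h2]
      abel
    refine ⟨g, hfil g hgl, fun a ha => ?_, hgl⟩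
    have h1 : a = ∑ i, b.repr ⟨a, ha⟩ i • (b i : M) := by
      have := congrArg M1.subtype (b.sum_repr ⟨a, ha⟩)
      rw [map_sum] at this
      exact this.symm
    have h2 := phi_sum hM'0 Finset.univ (b.repr ⟨a, ha⟩)
      (fun i => ⟨g (b i), hfil g hgl _ (b i).2⟩)
    rw [h1, phi_sum hM0, map_sum, map_sum]
    simp only [map_smul]
    rw [h2]
    refine Finset.sum_congr rfl fun i _ => ?_
    rw [← hB, hgb]
  · intro g g' hg hgl hg' hgl'
    have hk : ∀ x, (g - g') x ∈ LinearMap.ker θ' := by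
      intro x
      rw [LinearMap.mem_ker, LinearMap.sub_apply, map_sub, sub_eq_zero]
      exact (LinearMap.congr_fun hgl x).trans (LinearMap.congr_fun hgl' x).symm
    let h : M →ₗ[PowerSeries k] LinearMap.ker θ' := LinearMap.codRestrict _ (g - g') hk
    have hval : ∀ x, (h x : M') = g x - g' x := fun x => rfl
    have hc : B.constr (PowerSeries k) (fun i => h (B i)) = h := B.ext fun i => by
      rw [B.constr_basis]
    have hz : (fun i => h (B i)) = 0 := by
      apply (injective_iff_map_eq_zero _).1 hbij.1
      ext i
      change ((h (B i) - psi B (fun i => (b i : M)) φ (fun i => h (B i)) i :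
        LinearMap.ker θ') : M') = 0
      rw [psi_apply, hc, Submodule.coe_sub, hφ]
      have h1 : g (b i) = (h (b i) : M') + g' (b i) := by rw [hval]; abel
      have h2 := hM'0.1 _ (hker' (h (b i)).2) _ (hfil g' hgl' _ (b i).2)
      rw [← h1] at h2
      rw [hval, hB, hg _ (b i).2, hg' _ (b i).2, h2]
      abel
    apply B.ext
    intro i
    have h1 := congrArg Subtype.val (congrFun hz i)
    exact sub_eq_zero.1 h1

end Main

end PhiLiftAux

/-- **Corollary 1.2(a)** of Abrashkin, "Group schemes of period 2":
if `θ : 𝓜 → 𝓝` and `θ' : 𝓜' → 𝓝` are nilpotent `φ₁`-lifts with the same target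
`𝓝 ∈ 𝓜𝓕_S` (`𝓜, 𝓜' ∈ MF^e_S`), then there is a unique isomorphism
`g : 𝓜 → 𝓜'` in `MF^e_S` with `θ' ∘ g = θ`. -/
theorem nilpotent_phiLift_source_unique_up_to_unique_iso
    (k : Type) [Field k] [CharP k 2] [IsAlgClosed k]
    (e : ℕ) (he : 1 ≤ e)
    (M : Type) [AddCommGroup M] [Module (PowerSeries k) M]
    (M' : Type) [AddCommGroup M'] [Module (PowerSeries k) M']
    (N : Type) [AddCommGroup N] [Module (PowerSeries k) N]
    (M1 : Submodule (PowerSeries k) M) (M'1 : Submodule (PowerSeries k) M')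
    (N1 : Submodule (PowerSeries k) N)
    (φM : M → M) (φM' : M' → M') (φN : N → N)
    (hM : IsMFeTriple k e M M1 φM) (hM' : IsMFeTriple k e M' M'1 φM')
    (hN : IsMFTriple k N N1 φN)
    (θ : M →ₗ[PowerSeries k] N) (θ' : M' →ₗ[PowerSeries k] N)
    (hθ : IsNilpotentPhiLift k M N M1 N1 φM φN θ)
    (hθ' : IsNilpotentPhiLift k M' N M'1 N1 φM' φN θ') :
    ∃! g : M ≃ₗ[PowerSeries k] M',
      M1.map (g : M →ₗ[PowerSeries k] M') = M'1 ∧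
      (∀ a ∈ M1, g (φM a) = φM' (g a)) ∧
      θ' ∘ₗ (g : M →ₗ[PowerSeries k] M') = θ := by
  obtain ⟨⟨g, hg1, hg2, hg3⟩, huniq⟩ := PhiLiftAux.exists_unique_hom hM hM' hN hθ hθ'
  obtain ⟨⟨f, hf1, hf2, hf3⟩, -⟩ := PhiLiftAux.exists_unique_hom hM' hM hN hθ' hθ
  have hMM := (PhiLiftAux.exists_unique_hom hM hM hN hθ hθ).2
  have hMM' := (PhiLiftAux.exists_unique_hom hM' hM' hN hθ' hθ').2
  have e1 : f ∘ₗ g = LinearMap.id := by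
    apply hMM
    · intro a ha
      rw [LinearMap.comp_apply, hg2 a ha, hf2 _ (hg1 a ha), LinearMap.comp_apply]
    · rw [← LinearMap.comp_assoc, hf3, hg3]
    · intro a _; rfl
    · rfl
  have e2 : g ∘ₗ f = LinearMap.id := by
    apply hMM'
    · intro a ha
      rw [LinearMap.comp_apply, hf2 a ha, hg2 _ (hf1 a ha), LinearMap.comp_apply]
    · rw [← LinearMap.comp_assoc, hg3, hf3]
    · intro a _; rfl
    · rfl
  refine ⟨LinearEquiv.ofLinearMap g f e2 e1, ⟨?_, hg2, ?_⟩, ?_⟩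
  · apply le_antisymm
    · rintro _ ⟨a, ha, rfl⟩
      exact hg1 a ha
    · intro a ha
      exact ⟨f a, hf1 a ha, LinearMap.congr_fun e2 a⟩
  · exact hg3
  · rintro g' ⟨-, h2, h3⟩
    apply LinearEquiv.toLinearMap_injective
    exact huniq _ _ h2 h3 hg2 hg3
end
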